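/- arXiv:1810.11967 — 9 statements merged into one kernel-verified Lean document; each statement's English description precedes it below -/
import Mathlib

section
/- Let A be an ISM parameter matrix of g on X, let α : ℝ → ℝ, and choose points a_1,…,a_n ∈ ℝ with L(A_i) ≤ a_i ≤ U(A_i) for every i; set ω = Σ_{i=1}^n a_i. Suppose r ≥ 0 satisfies |Σ_{i=1}^n α(ω + δ_i) − (n−1)α(ω) − α(ω + Σ_{i=1}^n δ_i)| ≤ r for every δ ∈ ℝ^n with L(A_i) ≤ a_i + δ_i ≤ U(A_i) for all i. Suppose C'_i^j = [C̲'_i^j, C̄'_i^j] are intervals such that α(ω − a_i + y) − ((n−1)/n)·α(ω) ∈ C'_i^j for every y ∈ A_i^j, every i ∈ {1,…,n} and j ∈ {1,…,N}. Fix any k ∈ {1,…,n} and define C_k^j = C'_k^j + [−r, r] for all j and C_i^j = C'_i^j for i ≠ k. Then C is an ISM parameter matrix of α ∘ g on X, i.e., for every multi-index j ∈ {1,…,N}^n and every x ∈ Ξ^j, Σ_{i=1}^n C̲_i^{j_i} ≤ α(g(x)) ≤ Σ_{i=1}^n C̄_i^{j_i}. -/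
/-- `x` lies in the grid box `Ξ^j = ∏_i X_i^{j i}` of the uniform `N`-partition of
`∏_i [xl i, xu i]`, where `X_i^j = [xl i + j·h_i, xl i + (j+1)·h_i]` with
`h_i = (xu i - xl i)/N` (0-based indexing of the `N` subintervals). -/
def InGridBox {n N : ℕ} (xl xu : Fin n → ℝ) (j : Fin n → Fin N) (x : Fin n → ℝ) : Prop :=
  ∀ i, xl i + (j i : ℝ) * ((xu i - xl i) / N) ≤ x i ∧
       x i ≤ xl i + ((j i : ℝ) + 1) * ((xu i - xl i) / N)

/-- `(Al, Au)` is an interval superposition model (ISM) parameter matrix of `f` on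
`X = ∏_i [xl i, xu i]`: on each grid box `Ξ^j` the value `f x` is enclosed between
`∑ i, Al i (j i)` and `∑ i, Au i (j i)`. -/
def IsISM {n N : ℕ} (xl xu : Fin n → ℝ) (Al Au : Fin n → Fin N → ℝ)
    (f : (Fin n → ℝ) → ℝ) : Prop :=
  ∀ j : Fin n → Fin N, ∀ x : Fin n → ℝ, InGridBox xl xu j x →
    (∑ i, Al i (j i)) ≤ f x ∧ f x ≤ ∑ i, Au i (j i)

/-- Any real number between `∑ i, l i` and `∑ i, u i` is a sum of points of the
intervals `[l i, u i]`. -/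
theorem exists_sum_eq_of_mem_Icc {ι : Type*} [Fintype ι] {l u : ι → ℝ} (hlu : ∀ i, l i ≤ u i)
    {s : ℝ} (hl : ∑ i, l i ≤ s) (hu : s ≤ ∑ i, u i) :
    ∃ y : ι → ℝ, (∀ i, l i ≤ y i ∧ y i ≤ u i) ∧ ∑ i, y i = s := by
  obtain ⟨t, ⟨ht0, ht1⟩, ht⟩ := intermediate_value_Icc (zero_le_one' ℝ)
    (f := fun t => ∑ i, (l i + t * (u i - l i))) (by fun_prop) (show s ∈ _ by simpa using ⟨hl, hu⟩)
  refine ⟨fun i => l i + t * (u i - l i), fun i => ⟨?_, ?_⟩, ht⟩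
  · nlinarith [hlu i]
  · nlinarith [hlu i]

/-- Changing a function by `c` at a single point changes its sum by `c`. -/
theorem sum_eq_sum_add_of_eq_off {ι : Type*} [Fintype ι] {f f' : ι → ℝ} (k : ι) {c : ℝ}
    (hk : f k = f' k + c) (hne : ∀ i, i ≠ k → f i = f' i) :
    ∑ i, f i = ∑ i, f' i + c := by
  classical
  rw [← Finset.add_sum_erase _ f (Finset.mem_univ k),
    ← Finset.add_sum_erase _ f' (Finset.mem_univ k), hk,
    Finset.sum_congr rfl fun i hi => hne i (Finset.ne_of_mem_erase hi)]
  ring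

/-- Soundness of the univariate composition rule of interval superposition arithmetic. -/
theorem ism_univariate_composition
    (n N : ℕ) [NeZero n] [NeZero N]
    (xl xu : Fin n → ℝ)
    (Al Au : Fin n → Fin N → ℝ) (hAle : ∀ i j, Al i j ≤ Au i j)
    (g : (Fin n → ℝ) → ℝ) (hA : IsISM xl xu Al Au g)
    (α : ℝ → ℝ)
    (LA UA : Fin n → ℝ)
    (hLA : ∀ i, LA i = Finset.univ.inf' Finset.univ_nonempty (Al i))
    (hUA : ∀ i, UA i = Finset.univ.sup' Finset.univ_nonempty (Au i))
    (a : Fin n → ℝ) (ha : ∀ i, LA i ≤ a i ∧ a i ≤ UA i)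
    (ω : ℝ) (hω : ω = ∑ i, a i)
    (r : ℝ) (hr0 : 0 ≤ r)
    (hr : ∀ δ : Fin n → ℝ, (∀ i, LA i ≤ a i + δ i ∧ a i + δ i ≤ UA i) →
      |(∑ i, α (ω + δ i)) - ((n : ℝ) - 1) * α ω - α (ω + ∑ i, δ i)| ≤ r)
    (C'l C'u : Fin n → Fin N → ℝ)
    (hC' : ∀ i j, ∀ y : ℝ, Al i j ≤ y → y ≤ Au i j →
      C'l i j ≤ α (ω - a i + y) - (((n : ℝ) - 1) / (n : ℝ)) * α ω ∧
      α (ω - a i + y) - (((n : ℝ) - 1) / (n : ℝ)) * α ω ≤ C'u i j)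
    (k : Fin n)
    (Cl Cu : Fin n → Fin N → ℝ)
    (hCk : ∀ j, Cl k j = C'l k j - r ∧ Cu k j = C'u k j + r)
    (hCi : ∀ i, i ≠ k → ∀ j, Cl i j = C'l i j ∧ Cu i j = C'u i j) :
    IsISM xl xu Cl Cu (fun x => α (g x)) := by
  intro j x hx
  obtain ⟨hgl, hgu⟩ := hA j x hx
  obtain ⟨y, hy, hys⟩ := exists_sum_eq_of_mem_Icc (fun i => hAle i (j i)) hgl hgu
  have hδ := hr (fun i => y i - a i) fun i => by
    rw [add_sub_cancel, hLA, hUA]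
    exact ⟨(Finset.inf'_le _ (Finset.mem_univ (j i))).trans (hy i).1,
      (hy i).2.trans (Finset.le_sup' _ (Finset.mem_univ (j i)))⟩
  rw [Finset.sum_sub_distrib, hys, ← hω, add_sub_cancel, abs_le] at hδ
  have hn : (n : ℝ) ≠ 0 := NeZero.ne _
  have hsum : ∑ i, (α (ω - a i + y i) - (((n : ℝ) - 1) / (n : ℝ)) * α ω) =
      ∑ i, α (ω + (y i - a i)) - ((n : ℝ) - 1) * α ω := by
    rw [Finset.sum_sub_distrib, Finset.sum_const, Finset.card_univ, Fintype.card_fin,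
      nsmul_eq_mul, ← mul_assoc, mul_div_cancel₀ _ hn]
    congr 1
    exact Finset.sum_congr rfl fun i _ => by ring_nf
  have hl := Finset.sum_le_sum fun i (_ : i ∈ Finset.univ) =>
    (hC' i (j i) (y i) (hy i).1 (hy i).2).1
  have hu := Finset.sum_le_sum fun i (_ : i ∈ Finset.univ) =>
    (hC' i (j i) (y i) (hy i).1 (hy i).2).2
  rw [hsum] at hl hu
  have hCl : ∑ i, Cl i (j i) = ∑ i, C'l i (j i) + -r :=
    sum_eq_sum_add_of_eq_off k (hCk (j k)).1 fun i hi => (hCi i hi (j i)).1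
  have hCu : ∑ i, Cu i (j i) = ∑ i, C'u i (j i) + r :=
    sum_eq_sum_add_of_eq_off k (hCk (j k)).2 fun i hi => (hCi i hi (j i)).2
  rw [hCl, hCu]
  constructor <;> linarith [hδ.1, hδ.2]
end

section
/- Let n be a positive integer and let δ, ε, ρ, σ ∈ ℝ^n satisfy |δ_i| ≤ ρ_i and |ε_i| ≤ σ_i for all i ∈ {1,…,n}. Then |(Σ_{i=1}^n δ_i)·(Σ_{i=1}^n ε_i) − Σ_{i=1}^n δ_i ε_i| ≤ (Σ_{i=1}^n ρ_i)·(Σ_{i=1}^n σ_i) − Σ_{i=1}^n ρ_i σ_i. -/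
theorem Finset.sum_mul_sum_sub_sum_mul {ι R : Type*} [DecidableEq ι] [CommRing R]
    (s : Finset ι) (a b : ι → R) :
    (∑ i ∈ s, a i) * (∑ i ∈ s, b i) - ∑ i ∈ s, a i * b i =
      ∑ i ∈ s, ∑ j ∈ s.erase i, a i * b j := by
  rw [Finset.sum_mul_sum, ← Finset.sum_sub_distrib]
  refine Finset.sum_congr rfl fun i hi => ?_
  rw [sub_eq_iff_eq_add, Finset.sum_erase_add _ _ hi]

/-- Remainder bound underlying the product rule of interval superposition arithmetic:
the off-diagonal part of the product of two sums of bounded quantities is bounded by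
the corresponding off-diagonal part of the products of their bounds. -/
theorem offdiagonal_product_remainder_bound
    (n : ℕ) (hn : 0 < n) (δ ε ρ σ : Fin n → ℝ)
    (hδ : ∀ i, |δ i| ≤ ρ i) (hε : ∀ i, |ε i| ≤ σ i) :
    |(∑ i, δ i) * (∑ i, ε i) - ∑ i, δ i * ε i| ≤
      (∑ i, ρ i) * (∑ i, σ i) - ∑ i, ρ i * σ i := by
  simp only [Finset.sum_mul_sum_sub_sum_mul]
  refine (Finset.abs_sum_le_sum_abs _ _).trans (Finset.sum_le_sum fun i _ => ?_)
  refine (Finset.abs_sum_le_sum_abs _ _).trans (Finset.sum_le_sum fun j _ => ?_)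
  rw [abs_mul]
  exact mul_le_mul (hδ i) (hε j) (abs_nonneg _) ((abs_nonneg _).trans (hδ i))
end

section
/- Let n be a positive integer, let a_1,…,a_n, b_1,…,b_n ∈ ℝ and let ρ_i ≥ 0, σ_i ≥ 0. Set a = Σ_{i=1}^n a_i, b = Σ_{i=1}^n b_i, c = Σ_{i=1}^n a_i b_i, and ω = (ab − c)/n. Then for all y, z ∈ ℝ^n with |y_i − a_i| ≤ ρ_i and |z_i − b_i| ≤ σ_i for every i, one has |(Σ_{i=1}^n y_i)·(Σ_{i=1}^n z_i) − Σ_{i=1}^n [ (y_i + a − a_i)(z_i + b − b_i) − (a − a_i)(b − b_i) − ω ]| ≤ (Σ_{i=1}^n ρ_i)·(Σ_{i=1}^n σ_i) − Σ_{i=1}^n ρ_i σ_i. -/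
/-- The product of two sums minus its diagonal part is the sum of the off-diagonal products. -/
theorem sum_mul_sum_sub_diagonal {ι R : Type*} [Fintype ι] [DecidableEq ι] [CommRing R]
    (u v : ι → R) :
    (∑ i, u i) * (∑ i, v i) - ∑ i, u i * v i =
      ∑ i, ∑ j ∈ Finset.univ.erase i, u i * v j := by
  rw [Finset.sum_mul_sum, ← Finset.sum_sub_distrib]
  refine Finset.sum_congr rfl fun i _ => ?_
  rw [Finset.sum_erase_eq_sub (Finset.mem_univ i)]

/-- Off-diagonal products of sums are monotone in the absolute values of the summands. -/
theorem abs_sum_mul_sum_sub_diagonal_le {ι R : Type*} [Fintype ι]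
    [CommRing R] [LinearOrder R] [IsStrictOrderedRing R] {u v ρ σ : ι → R}
    (hu : ∀ i, |u i| ≤ ρ i) (hv : ∀ i, |v i| ≤ σ i) :
    |(∑ i, u i) * (∑ i, v i) - ∑ i, u i * v i| ≤
      (∑ i, ρ i) * (∑ i, σ i) - ∑ i, ρ i * σ i := by
  classical
  rw [sum_mul_sum_sub_diagonal, sum_mul_sum_sub_diagonal]
  refine (Finset.abs_sum_le_sum_abs _ _).trans (Finset.sum_le_sum fun i _ => ?_)
  refine (Finset.abs_sum_le_sum_abs _ _).trans (Finset.sum_le_sum fun j _ => ?_)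
  rw [abs_mul]
  exact mul_le_mul (hu i) (hv j) (abs_nonneg _) ((abs_nonneg _).trans (hu i))

/-- The exact algebraic decomposition used in the product rule of interval superposition
arithmetic together with its remainder bound: the product of two sums equals the sum of
the separable terms `(yᵢ + a − aᵢ)(zᵢ + b − bᵢ) − (a − aᵢ)(b − bᵢ) − ω` up to an error
controlled by the half-widths `ρᵢ, σᵢ`. -/
theorem product_rule_decomposition_remainder
    (n : ℕ) (hn : 0 < n)
    (a' b' : Fin n → ℝ) (ρ σ : Fin n → ℝ)
    (hρ : ∀ i, 0 ≤ ρ i) (hσ : ∀ i, 0 ≤ σ i)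
    (a b c ω : ℝ)
    (ha : a = ∑ i, a' i) (hb : b = ∑ i, b' i) (hc : c = ∑ i, a' i * b' i)
    (hω : ω = (a * b - c) / n)
    (y z : Fin n → ℝ)
    (hy : ∀ i, |y i - a' i| ≤ ρ i) (hz : ∀ i, |z i - b' i| ≤ σ i) :
    |(∑ i, y i) * (∑ i, z i) -
        ∑ i, ((y i + a - a' i) * (z i + b - b' i) - (a - a' i) * (b - b' i) - ω)| ≤
      (∑ i, ρ i) * (∑ i, σ i) - ∑ i, ρ i * σ i := by
  have hnω : (n : ℝ) * ω = a * b - c := by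
    rw [hω]
    field_simp
  have hterm : ∀ i, (y i + a - a' i) * (z i + b - b' i) - (a - a' i) * (b - b' i) - ω =
      (y i - a' i) * (z i - b' i) + b * y i + a * z i - a' i * b' i - ω := fun i => by
    ring
  have hsum : ∑ i, ((y i + a - a' i) * (z i + b - b' i) - (a - a' i) * (b - b' i) - ω) =
      ∑ i, (y i - a' i) * (z i - b' i) + b * ∑ i, y i + a * ∑ i, z i - a * b := by
    simp only [hterm, Finset.sum_sub_distrib, Finset.sum_add_distrib, ← Finset.mul_sum,
      Finset.sum_const, Finset.card_univ, Fintype.card_fin, nsmul_eq_mul, hnω, ← hc]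
    ring
  have hdiff : (∑ i, y i) * (∑ i, z i) -
        ∑ i, ((y i + a - a' i) * (z i + b - b' i) - (a - a' i) * (b - b' i) - ω) =
      (∑ i, (y i - a' i)) * (∑ i, (z i - b' i)) - ∑ i, (y i - a' i) * (z i - b' i) := by
    rw [hsum, Finset.sum_sub_distrib y a', Finset.sum_sub_distrib z b', ← ha, ← hb]
    ring
  rw [hdiff]
  exact abs_sum_mul_sum_sub_diagonal_le hy hz
end

section
/- Let A be an ISM parameter matrix of f on X and let Y = [y̲, ȳ] ⊂ ℝ be an interval. For each i ∈ {1,…,n}, let π_i be a permutation of {1,…,N} sorting the upper bounds of row i decreasingly, i.e., Ā_i^{π_i(1)} ≥ Ā_i^{π_i(2)} ≥ … ≥ Ā_i^{π_i(N)}. Suppose a multi-index j* ∈ {1,…,N}^n satisfies Σ_{i=1}^n Ā_i^{π_i(j*_i)} < y̲. Then for every multi-index j ∈ {1,…,N}^n with j_i ≥ j*_i for all i, the grid box Ξ^{(π_1(j_1),…,π_n(j_n))} contains no point of the set {x ∈ X : f(x) ∈ [y̲, ȳ]}. -/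
/-- Box-elimination guarantee of the sorting-based intersection algorithm (upper
bounds sorted decreasingly): if the sum of the sorted upper bounds at `j*` is below
`y̲`, then every grid box with sorted index `j ≥ j*` (componentwise) contains no point
of `{x ∈ X : f x ∈ [y̲, ȳ]}`. -/
theorem ism_sorted_elimination_upper
    (n N : ℕ) (xl xu : Fin n → ℝ)
    (Al Au : Fin n → Fin N → ℝ) (hAle : ∀ i j, Al i j ≤ Au i j)
    (f : (Fin n → ℝ) → ℝ) (hA : IsISM xl xu Al Au f)
    (yl yu : ℝ) (hy : yl ≤ yu)
    (π : Fin n → Equiv.Perm (Fin N))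
    (hsort : ∀ i, ∀ j j' : Fin N, j ≤ j' → Au i (π i j') ≤ Au i (π i j))
    (jstar : Fin n → Fin N)
    (hjstar : (∑ i, Au i (π i (jstar i))) < yl) :
    ∀ j : Fin n → Fin N, (∀ i, jstar i ≤ j i) →
      ∀ x : Fin n → ℝ, InGridBox xl xu (fun i => π i (j i)) x →
        x ∉ {x : Fin n → ℝ | (∀ i, xl i ≤ x i ∧ x i ≤ xu i) ∧ f x ∈ Set.Icc yl yu} := by
  intro j hj x hx hmem
  have hsum : ∑ i, Au i (π i (j i)) ≤ ∑ i, Au i (π i (jstar i)) :=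
    Finset.sum_le_sum fun i _ => hsort i _ _ (hj i)
  exact (((hA _ x hx).2.trans hsum).trans_lt hjstar).not_ge hmem.2.1
end

section
/- Let A be an ISM parameter matrix of f on X and let Y = [y̲, ȳ] ⊂ ℝ be an interval. For each i ∈ {1,…,n}, let π_i be a permutation of {1,…,N} sorting the lower bounds of row i increasingly, i.e., A̲_i^{π_i(1)} ≤ A̲_i^{π_i(2)} ≤ … ≤ A̲_i^{π_i(N)}. Suppose a multi-index j* ∈ {1,…,N}^n satisfies Σ_{i=1}^n A̲_i^{π_i(j*_i)} > ȳ. Then for every multi-index j ∈ {1,…,N}^n with j_i ≥ j*_i for all i, the grid box Ξ^{(π_1(j_1),…,π_n(j_n))} contains no point of the set {x ∈ X : f(x) ∈ [y̲, ȳ]}. -/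
/-- Box-elimination guarantee of the sorting-based intersection algorithm (lower
bounds sorted increasingly): if the sum of the sorted lower bounds at `j*` exceeds
`ȳ`, then every grid box with sorted index `j ≥ j*` (componentwise) contains no point
of `{x ∈ X : f x ∈ [y̲, ȳ]}`. -/
theorem ism_sorted_elimination_lower
    (n N : ℕ) (xl xu : Fin n → ℝ)
    (Al Au : Fin n → Fin N → ℝ) (hAle : ∀ i j, Al i j ≤ Au i j)
    (f : (Fin n → ℝ) → ℝ) (hA : IsISM xl xu Al Au f)
    (yl yu : ℝ) (hy : yl ≤ yu)
    (π : Fin n → Equiv.Perm (Fin N))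
    (hsort : ∀ i, ∀ j j' : Fin N, j ≤ j' → Al i (π i j) ≤ Al i (π i j'))
    (jstar : Fin n → Fin N)
    (hjstar : yu < ∑ i, Al i (π i (jstar i))) :
    ∀ j : Fin n → Fin N, (∀ i, jstar i ≤ j i) →
      ∀ x : Fin n → ℝ, InGridBox xl xu (fun i => π i (j i)) x →
        x ∉ {x : Fin n → ℝ | (∀ i, xl i ≤ x i ∧ x i ≤ xu i) ∧ f x ∈ Set.Icc yl yu} := by
  rintro j hj x hx ⟨-, -, hfu⟩
  have hsum : ∑ i, Al i (π i (jstar i)) ≤ ∑ i, Al i (π i (j i)) :=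
    Finset.sum_le_sum fun i _ => hsort i _ _ (hj i)
  exact (hjstar.trans_le (hsum.trans (hA _ x hx).1)).not_ge hfu
end

section
/- Suppose f : ℝ^n → ℝ is separable, f(x) = Σ_{i=1}^n f_i(x_i), where each f_i : ℝ → ℝ is Lipschitz continuous with constant L_i on [x̲_i, x̄_i]. Define the interval matrix A by A_i^j = [inf_{t ∈ X_i^j} f_i(t), sup_{t ∈ X_i^j} f_i(t)]. Then A is an ISM parameter matrix of f on X, and for every multi-index j ∈ {1,…,N}^n the width of the enclosure on the grid box Ξ^j satisfies Σ_{i=1}^n Ā_i^{j_i} − Σ_{i=1}^n A̲_i^{j_i} ≤ (1/N) · Σ_{i=1}^n L_i (x̄_i − x̲_i). -/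
/-- On a compact interval, a Lipschitz bound controls the oscillation by `L * (b - a)`. -/
theorem abs_sub_le_mul_length_of_lipschitz {f : ℝ → ℝ} {a b L : ℝ}
    (h : ∀ s ∈ Set.Icc a b, ∀ t ∈ Set.Icc a b, |f s - f t| ≤ L * |s - t|)
    {s t : ℝ} (hs : s ∈ Set.Icc a b) (ht : t ∈ Set.Icc a b) :
    |f s - f t| ≤ L * (b - a) := by
  have hab : a ≤ b := hs.1.trans hs.2
  rcases hab.eq_or_lt with rfl | hlt
  · obtain rfl : s = a := le_antisymm hs.2 hs.1
    obtain rfl : t = s := le_antisymm ht.2 ht.1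
    simp
  · have hL : 0 ≤ L * |b - a| :=
      (abs_nonneg _).trans (h b (Set.right_mem_Icc.2 hab) a (Set.left_mem_Icc.2 hab))
    have hL' : 0 ≤ L := nonneg_of_mul_nonneg_left hL (abs_pos.2 (sub_pos.2 hlt).ne')
    exact (h s hs t ht).trans
      (mul_le_mul_of_nonneg_left
        (abs_le.2 ⟨by linarith [hs.1, ht.2], by linarith [hs.2, ht.1]⟩) hL')

theorem bddBelow_bddAbove_image_of_lipschitz {f : ℝ → ℝ} {a b L : ℝ}
    (h : ∀ s ∈ Set.Icc a b, ∀ t ∈ Set.Icc a b, |f s - f t| ≤ L * |s - t|) :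
    BddBelow (f '' Set.Icc a b) ∧ BddAbove (f '' Set.Icc a b) := by
  constructor
  · refine ⟨f a - L * (b - a), ?_⟩
    rintro _ ⟨t, ht, rfl⟩
    have hat := abs_sub_le_mul_length_of_lipschitz h
      (Set.left_mem_Icc.2 (ht.1.trans ht.2)) ht
    linarith [(abs_le.1 hat).2]
  · refine ⟨f a + L * (b - a), ?_⟩
    rintro _ ⟨t, ht, rfl⟩
    have hat := abs_sub_le_mul_length_of_lipschitz h
      (Set.left_mem_Icc.2 (ht.1.trans ht.2)) ht
    linarith [(abs_le.1 hat).1]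

theorem sSup_sub_sInf_image_le_of_lipschitz {f : ℝ → ℝ} {a b L : ℝ} (hab : a ≤ b)
    (h : ∀ s ∈ Set.Icc a b, ∀ t ∈ Set.Icc a b, |f s - f t| ≤ L * |s - t|) :
    sSup (f '' Set.Icc a b) - sInf (f '' Set.Icc a b) ≤ L * (b - a) := by
  have hne : (f '' Set.Icc a b).Nonempty := (Set.nonempty_Icc.2 hab).image f
  rw [sub_le_iff_le_add]
  refine csSup_le hne ?_
  rintro _ ⟨s, hs, rfl⟩
  rw [← sub_le_iff_le_add']
  refine le_csInf hne ?_
  rintro _ ⟨t, ht, rfl⟩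
  linarith [(abs_le.1 (abs_sub_le_mul_length_of_lipschitz h hs ht)).2]

/-- A cell of the uniform `N`-partition of `[a, b]` is contained in `[a, b]`. -/
theorem uniform_cell_subset_Icc {N : ℕ} {a b : ℝ} (hab : a ≤ b) (j : Fin N) :
    Set.Icc (a + (j : ℝ) * ((b - a) / N)) (a + ((j : ℝ) + 1) * ((b - a) / N)) ⊆
      Set.Icc a b := by
  have hN : (0 : ℝ) < N := by exact_mod_cast j.pos
  have hh : 0 ≤ (b - a) / N := div_nonneg (sub_nonneg.2 hab) hN.le
  have hj : (j : ℝ) + 1 ≤ N := by exact_mod_cast j.isLt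
  refine Set.Icc_subset_Icc (le_add_of_nonneg_right (by positivity)) ?_
  have hmul := mul_le_mul_of_nonneg_right hj hh
  rw [mul_div_cancel₀ _ hN.ne'] at hmul
  linarith

/-- For a separable function `f(x) = ∑ i, fᵢ(xᵢ)` with each `fᵢ` Lipschitz with constant
`Lᵢ` on `[x̲ᵢ, x̄ᵢ]`, the interval matrix of exact ranges of the `fᵢ` over the grid
subintervals is an ISM parameter matrix of `f`, and the enclosure width on every grid
box is at most `(1/N) · ∑ i, Lᵢ (x̄ᵢ − x̲ᵢ)`. -/
theorem ism_separable_accuracy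
    (n N : ℕ) (hN : 0 < N)
    (xl xu : Fin n → ℝ) (hx : ∀ i, xl i ≤ xu i)
    (fi : Fin n → ℝ → ℝ) (L : Fin n → ℝ)
    (hLip : ∀ i, ∀ s ∈ Set.Icc (xl i) (xu i), ∀ t ∈ Set.Icc (xl i) (xu i),
      |fi i s - fi i t| ≤ L i * |s - t|)
    (Al Au : Fin n → Fin N → ℝ)
    (hAl : ∀ i (j : Fin N), Al i j =
      sInf (fi i '' Set.Icc (xl i + (j : ℝ) * ((xu i - xl i) / N))
                            (xl i + ((j : ℝ) + 1) * ((xu i - xl i) / N))))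
    (hAu : ∀ i (j : Fin N), Au i j =
      sSup (fi i '' Set.Icc (xl i + (j : ℝ) * ((xu i - xl i) / N))
                            (xl i + ((j : ℝ) + 1) * ((xu i - xl i) / N)))) :
    IsISM xl xu Al Au (fun x => ∑ i, fi i (x i)) ∧
    ∀ j : Fin n → Fin N,
      (∑ i, Au i (j i)) - (∑ i, Al i (j i)) ≤ (1 / N) * ∑ i, L i * (xu i - xl i) := by
  have hcell : ∀ i (j : Fin N), ∀ s ∈ Set.Icc (xl i + (j : ℝ) * ((xu i - xl i) / N))
      (xl i + ((j : ℝ) + 1) * ((xu i - xl i) / N)),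
      ∀ t ∈ Set.Icc (xl i + (j : ℝ) * ((xu i - xl i) / N))
      (xl i + ((j : ℝ) + 1) * ((xu i - xl i) / N)),
      |fi i s - fi i t| ≤ L i * |s - t| := fun i j s hs t ht =>
    hLip i s (uniform_cell_subset_Icc (hx i) j hs) t (uniform_cell_subset_Icc (hx i) j ht)
  refine ⟨fun j x hxj => ⟨Finset.sum_le_sum fun i _ => ?_, Finset.sum_le_sum fun i _ => ?_⟩,
    fun j => ?_⟩
  · rw [hAl]
    exact csInf_le (bddBelow_bddAbove_image_of_lipschitz (hcell i (j i))).1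
      (Set.mem_image_of_mem _ (hxj i))
  · rw [hAu]
    exact le_csSup (bddBelow_bddAbove_image_of_lipschitz (hcell i (j i))).2
      (Set.mem_image_of_mem _ (hxj i))
  · rw [← Finset.sum_sub_distrib, Finset.mul_sum]
    refine Finset.sum_le_sum fun i _ => ?_
    have hh : 0 ≤ (xu i - xl i) / N := div_nonneg (sub_nonneg.2 (hx i)) N.cast_nonneg
    rw [hAl, hAu]
    refine (sSup_sub_sInf_image_le_of_lipschitz (by linarith) (hcell i (j i))).trans_eq ?_
    ring
end

section
/- Let n be a positive integer and let t, s ∈ ℝ^n satisfy |t_i| ≤ s_i for all i ∈ {1,…,n}. Then |∏_{i=1}^n (1 + t_i) − 1 − Σ_{i=1}^n t_i| ≤ ∏_{i=1}^n (1 + s_i) − 1 − Σ_{i=1}^n s_i. -/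
/-- The sum of all products of two or more of the `t i` over a finite set is dominated in
absolute value by the corresponding sum for bounds `s i` of the `|t i|`. -/
theorem Finset.abs_prod_one_add_sub_one_sub_sum_le {ι : Type*} (A : Finset ι) {t s : ι → ℝ}
    (h : ∀ i ∈ A, |t i| ≤ s i) :
    |(∏ i ∈ A, (1 + t i)) - 1 - ∑ i ∈ A, t i| ≤ (∏ i ∈ A, (1 + s i)) - 1 - ∑ i ∈ A, s i := by
  classical
  induction A using Finset.induction_on with
  | empty => simp
  | insert a A ha ih =>
    have ih := ih fun i hi => h i (Finset.mem_insert_of_mem hi)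
    have hta : |t a| ≤ s a := h a (Finset.mem_insert_self a A)
    have hsum : |∑ i ∈ A, t i| ≤ ∑ i ∈ A, s i :=
      (Finset.abs_sum_le_sum_abs t A).trans
        (Finset.sum_le_sum fun i hi => h i (Finset.mem_insert_of_mem hi))
    rw [Finset.prod_insert ha, Finset.prod_insert ha, Finset.sum_insert ha, Finset.sum_insert ha]
    generalize ∏ i ∈ A, (1 + t i) = P at *
    generalize ∏ i ∈ A, (1 + s i) = Q at *
    generalize ∑ i ∈ A, t i = T at *
    generalize ∑ i ∈ A, s i = S at *
    have hP : |P - 1| ≤ Q - 1 := by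
      calc |P - 1| = |(P - 1 - T) + T| := by ring_nf
        _ ≤ |P - 1 - T| + |T| := abs_add_le _ _
        _ ≤ Q - 1 := by linarith
    calc |(1 + t a) * P - 1 - (t a + T)| = |(P - 1 - T) + t a * (P - 1)| := by ring_nf
      _ ≤ |P - 1 - T| + |t a| * |P - 1| := (abs_add_le _ _).trans_eq (by rw [abs_mul])
      _ ≤ (Q - 1 - S) + s a * (Q - 1) :=
        add_le_add ih (mul_le_mul hta hP (abs_nonneg _) ((abs_nonneg _).trans hta))
      _ = (1 + s a) * Q - 1 - (s a + S) := by ring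

/-- Product-expansion inequality used for the remainder bound of the exponential in
interval superposition arithmetic: the sum of all products of two or more of the `tᵢ`
is dominated in absolute value by the corresponding sum for the bounds `sᵢ`. -/
theorem product_expansion_remainder_bound
    (n : ℕ) (hn : 0 < n) (t s : Fin n → ℝ) (ht : ∀ i, |t i| ≤ s i) :
    |(∏ i, (1 + t i)) - 1 - ∑ i, t i| ≤ (∏ i, (1 + s i)) - 1 - ∑ i, s i :=
  Finset.abs_prod_one_add_sub_one_sub_sum_le Finset.univ fun i _ => ht i
end

section
/- Let n be a positive integer, let a, L, U ∈ ℝ^n with L_i ≤ a_i ≤ U_i for all i, and set ω = Σ_{i=1}^n a_i and s_i = max{ exp(U_i − a_i) − 1, 1 − exp(L_i − a_i) }. Then for every δ ∈ ℝ^n with L_i ≤ a_i + δ_i ≤ U_i for all i, |Σ_{i=1}^n exp(ω + δ_i) − (n−1)·exp(ω) − exp(ω + Σ_{i=1}^n δ_i)| ≤ exp(ω) · ( ∏_{i=1}^n (1 + s_i) − Σ_{i=1}^n s_i − 1 ). -/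
/-- If `|t i| ≤ s i`, then `∏ (1 + t i) - 1` is dominated by `∏ (1 + s i) - 1`. -/
theorem abs_prod_one_add_sub_one_le {ι : Type*} (S : Finset ι) {t s : ι → ℝ}
    (h : ∀ i ∈ S, |t i| ≤ s i) :
    |(∏ i ∈ S, (1 + t i)) - 1| ≤ (∏ i ∈ S, (1 + s i)) - 1 := by
  classical
  induction S using Finset.induction_on with
  | empty => simp
  | insert i S hi ih =>
    rw [Finset.prod_insert hi, Finset.prod_insert hi]
    have hP := ih fun j hj => h j (Finset.mem_insert_of_mem hj)
    have ht := h i (Finset.mem_insert_self i S)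
    have h1 : |1 + t i| ≤ 1 + s i := by
      calc |1 + t i| ≤ |1| + |t i| := abs_add_le _ _
        _ ≤ 1 + s i := by rw [abs_one]; gcongr
    calc |(1 + t i) * (∏ j ∈ S, (1 + t j)) - 1|
        = |(1 + t i) * ((∏ j ∈ S, (1 + t j)) - 1) + t i| := by congr 1; ring
      _ ≤ |1 + t i| * |(∏ j ∈ S, (1 + t j)) - 1| + |t i| := by
        rw [← abs_mul]; exact abs_add_le _ _
      _ ≤ (1 + s i) * ((∏ j ∈ S, (1 + s j)) - 1) + s i :=
        add_le_add (mul_le_mul h1 hP (abs_nonneg _) ((abs_nonneg _).trans h1)) ht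
      _ = (1 + s i) * (∏ j ∈ S, (1 + s j)) - 1 := by ring

/-- If `|t i| ≤ s i`, then the part of `∏ (1 + t i)` of order at least two is dominated by the
corresponding part of `∏ (1 + s i)`. -/
theorem abs_prod_one_add_sub_sum_sub_one_le {ι : Type*} (S : Finset ι) {t s : ι → ℝ}
    (h : ∀ i ∈ S, |t i| ≤ s i) :
    |(∏ i ∈ S, (1 + t i)) - (∑ i ∈ S, t i) - 1| ≤
      (∏ i ∈ S, (1 + s i)) - (∑ i ∈ S, s i) - 1 := by
  classical
  induction S using Finset.induction_on with
  | empty => simp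
  | insert i S hi ih =>
    rw [Finset.prod_insert hi, Finset.prod_insert hi, Finset.sum_insert hi, Finset.sum_insert hi]
    have hS : ∀ j ∈ S, |t j| ≤ s j := fun j hj => h j (Finset.mem_insert_of_mem hj)
    have ht := h i (Finset.mem_insert_self i S)
    calc |(1 + t i) * (∏ j ∈ S, (1 + t j)) - (t i + ∑ j ∈ S, t j) - 1|
        = |((∏ j ∈ S, (1 + t j)) - (∑ j ∈ S, t j) - 1) +
            t i * ((∏ j ∈ S, (1 + t j)) - 1)| := by congr 1; ring
      _ ≤ |(∏ j ∈ S, (1 + t j)) - (∑ j ∈ S, t j) - 1| +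
            |t i| * |(∏ j ∈ S, (1 + t j)) - 1| := by
        rw [← abs_mul]; exact abs_add_le _ _
      _ ≤ ((∏ j ∈ S, (1 + s j)) - (∑ j ∈ S, s j) - 1) +
            s i * ((∏ j ∈ S, (1 + s j)) - 1) :=
        add_le_add (ih hS) (mul_le_mul ht (abs_prod_one_add_sub_one_le S hS) (abs_nonneg _)
          ((abs_nonneg _).trans ht))
      _ = (1 + s i) * (∏ j ∈ S, (1 + s j)) - (s i + ∑ j ∈ S, s j) - 1 := by ring

/-- Globally valid remainder bound for the exponential atom operation in the univariate
composition rule of interval superposition arithmetic. -/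
theorem exp_remainder_bound
    (n : ℕ) (hn : 0 < n)
    (a L U : Fin n → ℝ) (hLU : ∀ i, L i ≤ a i ∧ a i ≤ U i)
    (ω : ℝ) (hω : ω = ∑ i, a i)
    (s : Fin n → ℝ)
    (hs : ∀ i, s i = max (Real.exp (U i - a i) - 1) (1 - Real.exp (L i - a i)))
    (δ : Fin n → ℝ) (hδ : ∀ i, L i ≤ a i + δ i ∧ a i + δ i ≤ U i) :
    |(∑ i, Real.exp (ω + δ i)) - ((n : ℝ) - 1) * Real.exp ω -
        Real.exp (ω + ∑ i, δ i)| ≤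
      Real.exp ω * ((∏ i, (1 + s i)) - (∑ i, s i) - 1) := by
  have ht : ∀ i ∈ Finset.univ, |Real.exp (δ i) - 1| ≤ s i := by
    intro i _
    have hL : Real.exp (L i - a i) ≤ Real.exp (δ i) :=
      Real.exp_le_exp.mpr (by linarith [(hδ i).1])
    have hU : Real.exp (δ i) ≤ Real.exp (U i - a i) :=
      Real.exp_le_exp.mpr (by linarith [(hδ i).2])
    rw [hs i, abs_le']
    exact ⟨le_max_of_le_left (by linarith), le_max_of_le_right (by linarith)⟩
  have key := abs_prod_one_add_sub_sum_sub_one_le Finset.univ ht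
  have hrem : (∑ i, Real.exp (ω + δ i)) - ((n : ℝ) - 1) * Real.exp ω - Real.exp (ω + ∑ i, δ i) =
      -(Real.exp ω * ((∏ i, (1 + (Real.exp (δ i) - 1))) - (∑ i, (Real.exp (δ i) - 1)) - 1)) := by
    simp only [Real.exp_add, Real.exp_sum, ← Finset.mul_sum, add_sub_cancel,
      Finset.sum_sub_distrib, Finset.sum_const, Finset.card_univ, Fintype.card_fin, nsmul_eq_mul]
    ring
  rw [hrem, abs_neg, abs_mul, Real.abs_exp]
  exact mul_le_mul_of_nonneg_left key (Real.exp_pos ω).le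
end

section
/- Let L, U ∈ ℝ with L ≤ U and define g(a) = max{ exp(U − a) − 1, 1 − exp(L − a) } for a ∈ ℝ. Then g attains its minimum over ℝ at a* = log( (exp(U) + exp(L))/2 ), and the minimal value is g(a*) = (exp(U) − exp(L)) / (exp(U) + exp(L)); that is, for every a ∈ ℝ, g(a) ≥ (exp(U) − exp(L)) / (exp(U) + exp(L)), with equality at a = a*. -/
/-- Optimality of the central point for the exponential atom operation: the bound
`g(a) = max{exp(U − a) − 1, 1 − exp(L − a)}` is minimized over `a ∈ ℝ` at
`a* = log((exp U + exp L)/2)`, with minimal value `(exp U − exp L)/(exp U + exp L)`. -/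
theorem exp_central_point_optimal
    (L U : ℝ) (hLU : L ≤ U) :
    (∀ a : ℝ,
      (Real.exp U - Real.exp L) / (Real.exp U + Real.exp L) ≤
        max (Real.exp (U - a) - 1) (1 - Real.exp (L - a))) ∧
    max (Real.exp (U - Real.log ((Real.exp U + Real.exp L) / 2)) - 1)
        (1 - Real.exp (L - Real.log ((Real.exp U + Real.exp L) / 2))) =
      (Real.exp U - Real.exp L) / (Real.exp U + Real.exp L) := by
  have hU := Real.exp_pos U
  have hL := Real.exp_pos L
  have upper : (Real.exp U - Real.exp L) / (Real.exp U + Real.exp L) =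
      Real.exp U / ((Real.exp U + Real.exp L) / 2) - 1 := by
    field_simp
    ring
  have lower : (Real.exp U - Real.exp L) / (Real.exp U + Real.exp L) =
      1 - Real.exp L / ((Real.exp U + Real.exp L) / 2) := by
    field_simp
    ring
  refine ⟨fun a => ?_, ?_⟩
  · rw [Real.exp_sub, Real.exp_sub]
    rcases le_total (Real.exp a) ((Real.exp U + Real.exp L) / 2) with h | h
    · refine le_max_of_le_left ?_
      rw [upper]
      gcongr
    · refine le_max_of_le_right ?_
      rw [lower]
      gcongr
  · rw [Real.exp_sub, Real.exp_sub, Real.exp_log (by positivity), ← upper, ← lower, max_self]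
end
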